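/- Let G_0, G_1, …, G_m be Borel probability distributions on ℝ_{≥0} with finite mean, let (t_0, t_1, …, t_m) be drawn independently from G_0, …, G_m, and let μ be the distribution on ℝ_{≥0}^m of the valuation vector (v_1, …, v_m) with v_j = t_0 + t_j (a single unit-demand buyer with additive values). Then the optimal item-pricing revenue under μ is at least one eighth of the optimal lottery revenue under μ. -/

import Mathlib

open MeasureTheory

/-- A lottery over `m` items: allocation probabilities `q` with `q j ≥ 0`,
`∑ j, q j ≤ 1`, and a price `p ≥ 0`. -/
structure Lottery (m : ℕ) where
  q : Fin m → ℝ
  p : ℝ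
  q_nonneg : ∀ j, 0 ≤ q j
  q_sum_le_one : ∑ j, q j ≤ 1
  p_nonneg : 0 ≤ p

/-- The (expected) utility of lottery `ℓ` at valuation `v`. -/
def Lottery.util {m : ℕ} (ℓ : Lottery m) (v : Fin m → ℝ) : ℝ :=
  (∑ j, ℓ.q j * v j) - ℓ.p

/-- The probability vector of a possibly-absent lottery (`⊥` ↦ 0). -/
def selQ {m : ℕ} : Option (Lottery m) → Fin m → ℝ
  | some ℓ => ℓ.q
  | none => 0

/-- The price of a possibly-absent lottery (`⊥` ↦ 0). -/
def selP {m : ℕ} : Option (Lottery m) → ℝ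
  | some ℓ => ℓ.p
  | none => 0

/-- `s` is a utility-maximizing selection for the lottery menu `L`. -/
structure IsSelection {m : ℕ} (L : Set (Lottery m))
    (s : (Fin m → ℝ) → Option (Lottery m)) : Prop where
  measQ : ∀ j, Measurable fun v => selQ (s v) j
  measP : Measurable fun v => selP (s v)
  buy_opt : ∀ v : Fin m → ℝ, (∀ j, 0 ≤ v j) → ∀ ℓ : Lottery m, s v = some ℓ →
    ℓ ∈ L ∧ 0 ≤ ℓ.util v ∧ ∀ ℓ' ∈ L, ℓ'.util v ≤ ℓ.util v
  no_buy : ∀ v : Fin m → ℝ, (∀ j, 0 ≤ v j) → s v = none →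
    ∀ ℓ ∈ L, ℓ.util v ≤ 0

/-- Expected revenue of a selection under the valuation distribution `μ`. -/
noncomputable def lotteryRevenue {m : ℕ} (μ : Measure (Fin m → ℝ))
    (s : (Fin m → ℝ) → Option (Lottery m)) : ℝ :=
  ∫ v, selP (s v) ∂μ

/-- An item pricing: every lottery in the menu allocates some item
deterministically (its probability vector is a standard basis vector). -/
def IsItemPricing {m : ℕ} (L : Set (Lottery m)) : Prop :=
  ∀ ℓ ∈ L, ∃ j : Fin m, ℓ.q = fun j' => if j' = j then 1 else 0

/-- The optimal item-pricing revenue under `μ`. -/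
noncomputable def optItemPricingRev {m : ℕ} (μ : Measure (Fin m → ℝ)) : ℝ :=
  sSup {r : ℝ | ∃ (L : Set (Lottery m)) (s : (Fin m → ℝ) → Option (Lottery m)),
    L.Nonempty ∧ IsItemPricing L ∧ IsSelection L s ∧ r = lotteryRevenue μ s}

/-- The optimal lottery revenue under `μ`. -/
noncomputable def optLotteryRev {m : ℕ} (μ : Measure (Fin m → ℝ)) : ℝ :=
  sSup {r : ℝ | ∃ (L : Set (Lottery m)) (s : (Fin m → ℝ) → Option (Lottery m)),
    L.Nonempty ∧ IsSelection L s ∧ r = lotteryRevenue μ s}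

/-- A dominant-strategy incentive compatible, individually rational
deterministic single-item auction for `m` bidders: `x v = some j` means bidder
`j` wins, `x v = none` means no winner; `pay v j ≥ 0` is bidder `j`'s payment. -/
structure IsAuction {m : ℕ} (x : (Fin m → ℝ) → Option (Fin m))
    (pay : (Fin m → ℝ) → Fin m → ℝ) : Prop where
  measX : ∀ j : Fin m, MeasurableSet {v | x v = some j}
  measPay : ∀ j : Fin m, Measurable fun v => pay v j
  pay_nonneg : ∀ v j, 0 ≤ pay v j
  ic : ∀ v : Fin m → ℝ, (∀ j, 0 ≤ v j) → ∀ (j : Fin m) (v' : ℝ), 0 ≤ v' →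
    (if x (Function.update v j v') = some j then v j else 0)
        - pay (Function.update v j v') j
      ≤ (if x v = some j then v j else 0) - pay v j
  ir : ∀ v : Fin m → ℝ, (∀ j, 0 ≤ v j) → ∀ j : Fin m,
    0 ≤ (if x v = some j then v j else 0) - pay v j

/-- Expected revenue of a single-item auction under `μ`. -/
noncomputable def auctionRevenue {m : ℕ} (μ : Measure (Fin m → ℝ))
    (pay : (Fin m → ℝ) → Fin m → ℝ) : ℝ :=
  ∫ v, ∑ j, pay v j ∂μ

lemma exists_measurable_argmax (n : ℕ) (hn : 0 < n) :
    ∃ J : (Fin n → ℝ) → Fin n, Measurable J ∧ ∀ (t : Fin n → ℝ) (i : Fin n), t i ≤ t (J t) := by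
  classical
  have hex : ∀ t : Fin n → ℝ, ∃ N : ℕ, ∃ h : N < n, ∀ i, t i ≤ t ⟨N, h⟩ := by
    intro t
    have : Nonempty (Fin n) := ⟨⟨0, hn⟩⟩
    obtain ⟨j, hj⟩ := Finite.exists_max t
    exact ⟨j, j.2, hj⟩
  refine ⟨fun t => ⟨Nat.find (hex t), (Nat.find_spec (hex t)).1⟩, ?_,
    fun t i => (Nat.find_spec (hex t)).2 i⟩
  have hm : Measurable fun t => Nat.find (hex t) := by
    refine measurable_find hex fun k => ?_
    by_cases hk : k < n
    · simp only [hk, exists_true_left, Set.ofPred_forall]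
      exact MeasurableSet.iInter fun i =>
        measurableSet_le (measurable_pi_apply i) (measurable_pi_apply _)
    · simp [hk]
  refine measurable_to_countable' fun j => ?_
  have : (fun t => (⟨Nat.find (hex t), (Nat.find_spec (hex t)).1⟩ : Fin n)) ⁻¹' {j}
      = (fun t => Nat.find (hex t)) ⁻¹' {(j : ℕ)} := by
    ext t
    simp [Fin.ext_iff]
  rw [this]
  exact hm (measurableSet_singleton _)

/-- A lottery menu for a single item, offering allocation probabilities bounded by `c`, earns no
more than `c` times the best posted price, when selling costs `lam` per unit of probability. -/
lemma setIntegral_allocation_sub_utility_le (G : Measure ℝ) [IsProbabilityMeasure G]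
    (hG : Integrable id G) {S : Set ℝ} (hS : MeasurableSet S) (hS0 : ∀ t ∈ S, 0 ≤ t)
    {x u : ℝ → ℝ} (hx : Measurable x) {lam h c : ℝ} (hc : 0 ≤ c) (hh : 0 ≤ h)
    (hprice : ∀ p, lam ≤ p → (p - lam) * G.real (Set.Ici p) ≤ h)
    (hx0 : ∀ t ∈ S, 0 ≤ x t) (hxc : ∀ t ∈ S, x t ≤ c) (hu0 : ∀ t ∈ S, 0 ≤ u t)
    (hic : ∀ s ∈ S, ∀ t ∈ S, u s + x s * (t - s) ≤ u t) :
    ∫ t in S, (x t * (t - lam) - u t) ∂G ≤ c * h := by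
  by_cases h_int : IntegrableOn (fun t => x t * (t - lam) - u t) S G
  swap
  · rw [integral_undef h_int]
    positivity
  have habs : Integrable (fun t => |t - lam|) G := (hG.sub (integrable_const lam)).abs
  have habs0 : 0 ≤ ∫ t, |t - lam| ∂G := integral_nonneg fun t => abs_nonneg _
  have key : ∀ N : ℕ, ∫ t in S, (x t * (t - lam) - u t) ∂G
      ≤ c * h + c / ((N : ℝ) + 1) * ∫ t, |t - lam| ∂G := by
    intro N
    set δ : ℝ := c / ((N : ℝ) + 1) with hδ
    have hN : (0 : ℝ) < (N : ℝ) + 1 := by positivity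
    have hδ0 : 0 ≤ δ := by positivity
    have hδc : ((N + 1 : ℕ) : ℝ) * δ = c := by
      rw [hδ]; push_cast; field_simp
    let E : ℕ → Set ℝ := fun k => {t | t ∈ S ∧ ((k : ℝ) + 1) * δ ≤ x t}
    let p : ℕ → ℝ := fun k => sInf (E k)
    have hEm : ∀ k, MeasurableSet (E k) := fun k =>
      hS.inter (measurableSet_le measurable_const hx)
    have hEb : ∀ k, BddBelow (E k) := fun k => ⟨0, fun t ht => hS0 t ht.1⟩
    have hu : ∀ k : ℕ, ∀ t ∈ S, (k : ℝ) * δ ≤ x t →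
        δ * ∑ i ∈ Finset.range k, (t - p i) ≤ u t := by
      intro k
      induction k with
      | zero => intro t ht _; simpa using hu0 t ht
      | succ k ih =>
        intro t ht hxt
        push_cast at hxt
        have htE : t ∈ E k := ⟨ht, hxt⟩
        refine le_of_forall_pos_le_add fun ε hε => ?_
        obtain ⟨s, hs, hsp⟩ : ∃ s ∈ E k, s < p k + ε / (δ + 1) :=
          exists_lt_of_csInf_lt ⟨t, htE⟩ (by
            have : 0 < ε / (δ + 1) := by positivity
            change p k < _
            linarith)
        have hs' : ∃ s ∈ E k, s ≤ t ∧ s < p k + ε / (δ + 1) := by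
          rcases le_total s t with h1 | h1
          · exact ⟨s, hs, h1, hsp⟩
          · exact ⟨t, htE, le_rfl, h1.trans_lt hsp⟩
        obtain ⟨s, hs, hst, hsp⟩ := hs'
        have h1 := ih s hs.1 (by nlinarith [hs.2])
        have h2 := hic s hs.1 t ht
        have h3 : ((k : ℝ) + 1) * δ * (t - s) ≤ x s * (t - s) :=
          mul_le_mul_of_nonneg_right hs.2 (by linarith)
        have h4 : ∑ i ∈ Finset.range k, (t - p i)
            = ∑ i ∈ Finset.range k, (s - p i) + k * (t - s) := by
          simp only [Finset.sum_sub_distrib, Finset.sum_const, Finset.card_range, nsmul_eq_mul]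
          ring
        have h5 : δ * (s - p k) ≤ ε := by
          have : (δ + 1) * (ε / (δ + 1)) = ε := by field_simp
          have h6 : 0 < ε / (δ + 1) := by positivity
          nlinarith
        rw [Finset.sum_range_succ, h4]
        nlinarith
    have hpt : ∀ t ∈ S, x t * (t - lam) - u t
        ≤ ∑ k ∈ Finset.range (N + 1), δ * (E k).indicator (fun _ => p k - lam) t
          + δ * |t - lam| := by
      intro t ht
      obtain ⟨K, hKN, hK, hK1, hKE⟩ : ∃ K ≤ N + 1, (K : ℝ) * δ ≤ x t ∧
          x t ≤ ((K : ℝ) + 1) * δ ∧ ∀ k, K ≤ k → k < N + 1 → t ∉ E k := by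
        classical
        let P : ℕ → Prop := fun K => (K : ℝ) * δ ≤ x t
        have hP0 : P 0 := by simpa [P] using hx0 t ht
        refine ⟨Nat.findGreatest P (N + 1), Nat.findGreatest_le _,
          Nat.findGreatest_spec (P := P) (Nat.zero_le _) hP0, ?_, ?_⟩
        swap
        · intro k hk hkN hE
          refine Nat.findGreatest_is_greatest (P := P) (Nat.lt_succ_of_le hk) hkN ?_
          have := hE.2
          simpa [P] using this
        rcases (Nat.findGreatest_le (P := P) (N + 1)).lt_or_eq with hlt | heq
        · have := Nat.findGreatest_is_greatest (P := P) (Nat.lt_succ_self _) hlt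
          simp only [P, not_le] at this
          push_cast at this
          exact this.le
        · rw [heq]
          have := hxc t ht
          nlinarith
      have hle : ∑ k ∈ Finset.range K, δ * (p k - lam)
          ≤ ∑ k ∈ Finset.range (N + 1), δ * (E k).indicator (fun _ => p k - lam) t := by
        rw [← Finset.sum_subset (Finset.range_mono hKN)]
        · refine Finset.sum_le_sum fun k hk => ?_
          have hkK : ((k : ℝ) + 1) ≤ K := by exact_mod_cast Finset.mem_range.1 hk
          have htE : t ∈ E k := ⟨ht, by nlinarith⟩
          rw [Set.indicator_of_mem htE]
        · intro k hk hkK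
          rw [Set.indicator_of_notMem, mul_zero]
          exact hKE k (by simpa using hkK) (Finset.mem_range.1 hk)
      have h1 := hu K t ht hK
      have h2 : (x t - K * δ) * (t - lam) ≤ δ * |t - lam| := by
        have := le_abs_self (t - lam)
        have := abs_nonneg (t - lam)
        nlinarith
      have h3 : ∑ k ∈ Finset.range K, δ * (p k - lam)
          = K * δ * (t - lam) - δ * ∑ i ∈ Finset.range K, (t - p i) := by
        simp only [← Finset.mul_sum, Finset.sum_sub_distrib, Finset.sum_const, Finset.card_range,
          nsmul_eq_mul]
        ring
      linarith
    have hE : ∀ k, ∫ t in S, (E k).indicator (fun _ => p k - lam) t ∂G ≤ h := by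
      intro k
      rw [setIntegral_indicator (hEm k), setIntegral_const, smul_eq_mul,
        Set.inter_eq_self_of_subset_right fun t ht => ht.1]
      have h0 : 0 ≤ G.real (E k) := measureReal_nonneg
      rcases le_or_gt lam (p k) with hl | hl
      · have h1 : G.real (E k) ≤ G.real (Set.Ici (p k)) :=
          measureReal_mono fun t ht => csInf_le (hEb k) ht
        have h2 := hprice _ hl
        nlinarith
      · nlinarith
    have hEi : ∀ k, Integrable (fun t => δ * (E k).indicator (fun _ => p k - lam) t)
        (G.restrict S) := fun k => ((integrable_const _).indicator (hEm k)).const_mul _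
    calc ∫ t in S, (x t * (t - lam) - u t) ∂G
        ≤ ∫ t in S, (∑ k ∈ Finset.range (N + 1), δ * (E k).indicator (fun _ => p k - lam) t
          + δ * |t - lam|) ∂G :=
          setIntegral_mono_on h_int ((integrable_finsetSum _ fun k _ => hEi k).add
            (habs.integrableOn.const_mul _)) hS hpt
      _ = ∑ k ∈ Finset.range (N + 1), δ * ∫ t in S, (E k).indicator (fun _ => p k - lam) t ∂G
          + δ * ∫ t in S, |t - lam| ∂G := by
          rw [integral_add (integrable_finsetSum _ fun k _ => hEi k)
            (habs.integrableOn.const_mul _), integral_finsetSum _ fun k _ => hEi k]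
          simp only [integral_const_mul]
      _ ≤ ∑ k ∈ Finset.range (N + 1), δ * h + δ * ∫ t, |t - lam| ∂G := by
          gcongr with k
          · exact hE k
          · exact .of_forall fun t => abs_nonneg _
          · exact Measure.restrict_le_self
      _ = c * h + δ * ∫ t, |t - lam| ∂G := by
          rw [Finset.sum_const, Finset.card_range, nsmul_eq_mul, ← mul_assoc, hδc]
  have hlim : Filter.Tendsto
      (fun N : ℕ => c * h + c / ((N : ℝ) + 1) * ∫ t, |t - lam| ∂G) Filter.atTop
      (nhds (c * h + 0 * ∫ t, |t - lam| ∂G)) := by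
    refine tendsto_const_nhds.add (Filter.Tendsto.mul_const _ ?_)
    have := (tendsto_one_div_add_atTop_nhds_zero_nat (𝕜 := ℝ)).const_mul c
    simpa [div_eq_mul_inv] using this
  simpa using ge_of_tendsto' hlim key

/-- A bound on every one-coordinate section integral bounds the integral over a product. -/
lemma integral_pi_le_of_insertNth {n : ℕ} (G : Fin (n + 1) → Measure ℝ)
    [∀ j, IsProbabilityMeasure (G j)] {F : (Fin (n + 1) → ℝ) → ℝ} (hF : Integrable F (Measure.pi G))
    (j : Fin (n + 1)) {C : ℝ}
    (hC : ∀ r : Fin n → ℝ, ∫ s, F (j.insertNth s r) ∂(G j) ≤ C) :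
    ∫ t, F t ∂(Measure.pi G) ≤ C := by
  have hmp := (measurePreserving_piFinSuccAbove G j).symm
  have h_int : Integrable (fun z : ℝ × (Fin n → ℝ) => F (j.insertNth z.1 z.2))
      ((G j).prod (Measure.pi fun i => G (j.succAbove i))) :=
    (hmp.integrable_comp_emb (MeasurableEquiv.measurableEmbedding _)).2 hF
  have heq : ∫ t, F t ∂(Measure.pi G) = ∫ z : ℝ × (Fin n → ℝ), F (j.insertNth z.1 z.2)
      ∂((G j).prod (Measure.pi fun i => G (j.succAbove i))) :=
    (hmp.integral_comp (MeasurableEquiv.measurableEmbedding _) F).symm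
  rw [heq, integral_prod_symm _ h_int]
  calc _ ≤ ∫ _ : Fin n → ℝ, C ∂(Measure.pi fun i => G (j.succAbove i)) :=
        integral_mono h_int.integral_prod_right (integrable_const _) hC
    _ = C := by simp

/-- The menu with item prices `p` has a utility-maximizing selection that buys a favourite item
whenever this item is affordable. -/
lemma exists_itemPricing_selection {m : ℕ} (hm : 0 < m) (p : Fin m → ℝ) (hp : ∀ j, 0 ≤ p j) :
    ∃ (L : Set (Lottery m)) (s : (Fin m → ℝ) → Option (Lottery m)) (J : (Fin m → ℝ) → Fin m),
      L.Nonempty ∧ IsItemPricing L ∧ IsSelection L s ∧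
      (∀ v i, v i - p i ≤ v (J v) - p (J v)) ∧
      ∀ v, selP (s v) = if p (J v) ≤ v (J v) then p (J v) else 0 := by
  classical
  obtain ⟨J₀, hJm, hJ⟩ := exists_measurable_argmax m hm
  let e : Fin m → Lottery m := fun j =>
    { q := fun j' => if j' = j then 1 else 0
      p := p j
      q_nonneg := fun j' => by split_ifs <;> norm_num
      q_sum_le_one := by simp
      p_nonneg := hp j }
  have heu : ∀ j v, (e j).util v = v j - p j := fun j v => by simp [e, Lottery.util]
  let J : (Fin m → ℝ) → Fin m := fun v => J₀ (v - p)
  have hJmax : ∀ v i, v i - p i ≤ v (J v) - p (J v) := fun v i => hJ (v - p) i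
  have hJmeas : Measurable J := hJm.comp (measurable_id.sub_const p)
  let s : (Fin m → ℝ) → Option (Lottery m) := fun v =>
    if p (J v) ≤ v (J v) then some (e (J v)) else none
  have hvJ : Measurable fun v : Fin m → ℝ => v (J v) := by
    have : (fun v : Fin m → ℝ => v (J v)) = fun v => ∑ j, if J v = j then v j else 0 := by
      ext v; simp
    rw [this]
    exact Finset.measurable_sum _ fun j _ => Measurable.ite
      (hJmeas (measurableSet_singleton j)) (measurable_pi_apply j) measurable_const
  have hset : MeasurableSet {v : Fin m → ℝ | p (J v) ≤ v (J v)} :=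
    measurableSet_le ((measurable_of_countable p).comp hJmeas) hvJ
  have hsP : ∀ v, selP (s v) = if p (J v) ≤ v (J v) then p (J v) else 0 := by
    intro v
    simp only [s]
    split_ifs <;> simp [selP, e]
  refine ⟨Set.range e, s, J, ⟨e ⟨0, hm⟩, Set.mem_range_self _⟩, ?_, ⟨?_, ?_, ?_, ?_⟩, hJmax, hsP⟩
  · rintro _ ⟨j, rfl⟩
    exact ⟨j, rfl⟩
  · intro j
    have : (fun v => selQ (s v) j) =
        fun v => if p (J v) ≤ v (J v) then (if j = J v then (1 : ℝ) else 0) else 0 := by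
      ext v
      simp only [s]
      split_ifs <;> simp_all [selQ, e]
    rw [this]
    exact Measurable.ite hset ((measurable_of_countable fun i => if j = i then (1 : ℝ) else 0).comp
      hJmeas) measurable_const
  · simp_rw [hsP]
    exact Measurable.ite hset ((measurable_of_countable p).comp hJmeas) measurable_const
  · intro v _ ℓ hℓ
    simp only [s] at hℓ
    split_ifs at hℓ with h
    obtain rfl := Option.some.inj hℓ
    refine ⟨Set.mem_range_self _, by rw [heu]; linarith, ?_⟩
    rintro _ ⟨i, rfl⟩
    rw [heu, heu]
    exact hJmax v i
  · intro v _ hv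
    simp only [s] at hv
    split_ifs at hv with h
    rintro _ ⟨i, rfl⟩
    rw [heu]
    linarith [hJmax v i]

/-- Incentive compatibility and individual rationality of a selection, in terms of its indirect
utility. -/
lemma IsSelection.price_le {m : ℕ} {L : Set (Lottery m)}
    {s : (Fin m → ℝ) → Option (Lottery m)} (hs : IsSelection L s) {v : Fin m → ℝ}
    (hv : ∀ j, 0 ≤ v j) : selP (s v) ≤ ∑ j, selQ (s v) j * v j := by
  rcases h : s v with _ | ℓ
  · simp [selP, selQ]
  · have := (hs.buy_opt v hv ℓ h).2.1
    simp only [Lottery.util] at this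
    simp only [selP, selQ]
    linarith

lemma IsSelection.utility_ge {m : ℕ} {L : Set (Lottery m)}
    {s : (Fin m → ℝ) → Option (Lottery m)} (hs : IsSelection L s) {v w : Fin m → ℝ}
    (hv : ∀ j, 0 ≤ v j) (hw : ∀ j, 0 ≤ w j) :
    ∑ j, selQ (s w) j * v j - selP (s w) ≤ ∑ j, selQ (s v) j * v j - selP (s v) := by
  rcases h : s w with _ | ℓ
  · have := hs.price_le hv
    simp only [selP, selQ] at this ⊢
    simpa using this
  · have hℓ := (hs.buy_opt w hw ℓ h).1
    rcases h' : s v with _ | ℓ'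
    · have := hs.no_buy v hv h' ℓ hℓ
      simpa [selP, selQ, Lottery.util] using this
    · exact (hs.buy_opt v hv ℓ' h').2.2 ℓ hℓ

lemma selQ_nonneg {m : ℕ} (o : Option (Lottery m)) (j : Fin m) : 0 ≤ selQ o j := by
  rcases o with _ | ℓ
  · simp [selQ]
  · exact ℓ.q_nonneg j

lemma sum_selQ_le_one {m : ℕ} (o : Option (Lottery m)) : ∑ j, selQ o j ≤ 1 := by
  rcases o with _ | ℓ
  · simp [selQ]
  · exact ℓ.q_sum_le_one

lemma selQ_le_one {m : ℕ} (o : Option (Lottery m)) (j : Fin m) : selQ o j ≤ 1 :=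
  (Finset.single_le_sum (fun i _ => selQ_nonneg o i) (Finset.mem_univ j)).trans (sum_selQ_le_one o)

lemma selP_nonneg {m : ℕ} (o : Option (Lottery m)) : 0 ≤ selP o := by
  rcases o with _ | ℓ
  · simp [selP]
  · exact ℓ.p_nonneg

/-- The valuation vector induced by the type `t`. -/
def additiveVal {m : ℕ} (t : Fin (m + 1) → ℝ) (j : Fin m) : ℝ := t 0 + t j.succ

/-- The allocation seen as a function of types: the common component counts as an additional item
that is obtained together with any other item. -/
def typeAlloc {m : ℕ} (o : Option (Lottery m)) : Fin (m + 1) → ℝ :=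
  Fin.cons (∑ j, selQ o j) (selQ o)

lemma typeAlloc_nonneg {m : ℕ} (o : Option (Lottery m)) (i : Fin (m + 1)) :
    0 ≤ typeAlloc o i := by
  cases i using Fin.cases with
  | zero => exact (Finset.sum_nonneg fun j _ => selQ_nonneg o j : 0 ≤ ∑ j, selQ o j)
  | succ j => exact selQ_nonneg o j

lemma typeAlloc_le_one {m : ℕ} (o : Option (Lottery m)) (i : Fin (m + 1)) :
    typeAlloc o i ≤ 1 := by
  cases i using Fin.cases with
  | zero => exact sum_selQ_le_one o
  | succ j => exact selQ_le_one o j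

lemma sum_selQ_mul_additiveVal {m : ℕ} (o : Option (Lottery m)) (t : Fin (m + 1) → ℝ) :
    ∑ j, selQ o j * additiveVal t j = ∑ i, typeAlloc o i * t i := by
  simp [Fin.sum_univ_succ, typeAlloc, additiveVal, mul_add, Finset.sum_add_distrib,
    Finset.sum_mul]

lemma measurable_additiveVal {m : ℕ} : Measurable (additiveVal (m := m)) :=
  measurable_pi_lambda _ fun _ => (measurable_pi_apply _).add (measurable_pi_apply _)

lemma additiveVal_nonneg {m : ℕ} {t : Fin (m + 1) → ℝ} (ht : ∀ i, 0 ≤ t i) (j : Fin m) :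
    0 ≤ additiveVal t j := add_nonneg (ht _) (ht _)

lemma IsSelection.measurable_typeAlloc {m : ℕ} {L : Set (Lottery m)}
    {s : (Fin m → ℝ) → Option (Lottery m)} (hs : IsSelection L s) (i : Fin (m + 1)) :
    Measurable fun t => typeAlloc (s (additiveVal t)) i := by
  cases i using Fin.cases with
  | zero =>
    exact (Finset.measurable_sum Finset.univ fun j _ =>
      (hs.measQ j).comp measurable_additiveVal :
        Measurable fun t => ∑ j, selQ (s (additiveVal t)) j)
  | succ j => exact (hs.measQ j).comp measurable_additiveVal

/-- The indirect utility of a buyer of type `t`. -/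
noncomputable def typeUtil {m : ℕ} (s : (Fin m → ℝ) → Option (Lottery m))
    (t : Fin (m + 1) → ℝ) : ℝ :=
  ∑ i, typeAlloc (s (additiveVal t)) i * t i - selP (s (additiveVal t))

lemma IsSelection.measurable_typeUtil {m : ℕ} {L : Set (Lottery m)}
    {s : (Fin m → ℝ) → Option (Lottery m)} (hs : IsSelection L s) : Measurable (typeUtil s) :=
  (Finset.measurable_sum _ fun i _ => (hs.measurable_typeAlloc i).mul (measurable_pi_apply i)).sub
    (hs.measP.comp measurable_additiveVal)

lemma IsSelection.typeUtil_nonneg {m : ℕ} {L : Set (Lottery m)}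
    {s : (Fin m → ℝ) → Option (Lottery m)} (hs : IsSelection L s) {t : Fin (m + 1) → ℝ}
    (ht : ∀ i, 0 ≤ t i) : 0 ≤ typeUtil s t := by
  have := hs.price_le (additiveVal_nonneg ht)
  rw [sum_selQ_mul_additiveVal] at this
  simpa [typeUtil] using this

lemma IsSelection.typeUtil_ge {m : ℕ} {L : Set (Lottery m)}
    {s : (Fin m → ℝ) → Option (Lottery m)} (hs : IsSelection L s) {t t' : Fin (m + 1) → ℝ}
    (ht : ∀ i, 0 ≤ t i) (ht' : ∀ i, 0 ≤ t' i) :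
    typeUtil s t + ∑ i, typeAlloc (s (additiveVal t)) i * (t' i - t i) ≤ typeUtil s t' := by
  have := hs.utility_ge (additiveVal_nonneg ht') (additiveVal_nonneg ht)
  rw [sum_selQ_mul_additiveVal, sum_selQ_mul_additiveVal] at this
  simp only [typeUtil, mul_sub, Finset.sum_sub_distrib]
  linarith

lemma typeAlloc_sum_le {m : ℕ} (o : Option (Lottery m)) {t : Fin (m + 1) → ℝ}
    (ht : ∀ i, 0 ≤ t i) : ∑ i, typeAlloc o i * t i ≤ ∑ i, t i :=
  Finset.sum_le_sum fun i _ => mul_le_of_le_one_left (ht i) (typeAlloc_le_one o i)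

lemma typeUtil_le {m : ℕ} (s : (Fin m → ℝ) → Option (Lottery m)) {t : Fin (m + 1) → ℝ}
    (ht : ∀ i, 0 ≤ t i) : typeUtil s t ≤ ∑ i, t i :=
  (sub_le_self _ (selP_nonneg _)).trans (typeAlloc_sum_le _ ht)

lemma IsSelection.price_le_sum {m : ℕ} {L : Set (Lottery m)}
    {s : (Fin m → ℝ) → Option (Lottery m)} (hs : IsSelection L s) {t : Fin (m + 1) → ℝ}
    (ht : ∀ i, 0 ≤ t i) : selP (s (additiveVal t)) ≤ ∑ i, t i := by
  have := hs.price_le (additiveVal_nonneg ht)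
  rw [sum_selQ_mul_additiveVal] at this
  exact this.trans (typeAlloc_sum_le _ ht)

lemma measurableSet_forall_nonneg {n : ℕ} :
    MeasurableSet {t : Fin n → ℝ | ∀ i, 0 ≤ t i} := by
  have : {t : Fin n → ℝ | ∀ i, 0 ≤ t i} = ⋂ i, {t | 0 ≤ t i} := by
    ext t; simp
  rw [this]
  exact MeasurableSet.iInter fun i => measurableSet_le measurable_const (measurable_pi_apply i)

/-- Extra revenue from competition: on the event that coordinate `j` is the favourite `J t`, the
part of the lottery price charged for coordinate `j` together with `c` times the largest other
coordinate, minus `lam` per unit of allocation. -/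
noncomputable def favouriteExcess {m : ℕ} (s : (Fin m → ℝ) → Option (Lottery m))
    (J : (Fin (m + 1) → ℝ) → Fin (m + 1)) (j : Fin (m + 1)) (c lam : ℝ) :
    (Fin (m + 1) → ℝ) → ℝ :=
  {t | J t = j ∧ ∀ i, 0 ≤ t i}.indicator fun t =>
    (typeAlloc (s (additiveVal t)) j + c) * (t j - lam)
      - (typeUtil s t + c * (t j - ⨆ i, t (j.succAbove i)))

/-- The price paid by a type is at most the sum of the excesses charged to its coordinates, plus
the cost of the allocation to the items other than the common component. -/
lemma price_le_sum_favouriteExcess {m : ℕ} {s : (Fin m → ℝ) → Option (Lottery m)}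
    {J : (Fin (m + 1) → ℝ) → Fin (m + 1)} (hm : 0 < m)
    {lam : ℝ} (hlam : 0 ≤ lam) {t : Fin (m + 1) → ℝ} (ht : ∀ i, 0 ≤ t i) :
    selP (s (additiveVal t)) ≤ favouriteExcess s J 0 1 0 t
      + ∑ j : Fin m, favouriteExcess s J j.succ 2 lam t + 3 * lam := by
  have : Nonempty (Fin m) := ⟨⟨0, hm⟩⟩
  set k := J t with hk
  set o := s (additiveVal t) with ho
  set M := ⨆ i, t (k.succAbove i) with hM
  have hM0 : 0 ≤ M := Real.iSup_nonneg fun i => ht _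
  have hother : ∀ j c l, j ≠ k → favouriteExcess s J j c l t = 0 := fun j c l hj =>
    Set.indicator_of_notMem (fun h => hj h.1.symm) _
  have hself : ∀ c l, favouriteExcess s J k c l t
      = (typeAlloc o k + c) * (t k - l) - (typeUtil s t + c * (t k - M)) := fun c l =>
    Set.indicator_of_mem (show t ∈ {t | J t = k ∧ ∀ i, 0 ≤ t i} from ⟨rfl, ht⟩) _
  have hP : selP o = typeAlloc o k * t k
      + ∑ i, typeAlloc o (k.succAbove i) * t (k.succAbove i) - typeUtil s t := by
    rw [← Fin.sum_univ_succAbove (fun i => typeAlloc o i * t i) k, typeUtil]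
    ring
  have hrem : ∑ i, typeAlloc o (k.succAbove i) * t (k.succAbove i)
      ≤ (∑ i, typeAlloc o (k.succAbove i)) * M := by
    rw [Finset.sum_mul]
    exact Finset.sum_le_sum fun i _ => mul_le_mul_of_nonneg_left
      (le_ciSup (f := fun i => t (k.succAbove i)) (Set.finite_range _).bddAbove i)
      (typeAlloc_nonneg _ _)
  have htot : typeAlloc o k + ∑ i, typeAlloc o (k.succAbove i) = 2 * ∑ j, selQ o j := by
    rw [← Fin.sum_univ_succAbove (typeAlloc o) k, Fin.sum_univ_succ]
    simp only [typeAlloc, Fin.cons_zero, Fin.cons_succ]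
    ring
  have hq := sum_selQ_le_one o
  have hk0 := typeAlloc_nonneg o k
  have hk1 := typeAlloc_le_one o k
  rcases Fin.eq_zero_or_eq_succ k with h0 | ⟨k', hk'⟩
  · have hz : typeAlloc o k = ∑ j, selQ o j := by rw [h0]; rfl
    rw [Finset.sum_eq_zero fun j _ => hother j.succ 2 lam (h0 ▸ Fin.succ_ne_zero j), ← h0,
      hself, hP]
    nlinarith
  · rw [hother 0 1 0 (hk' ▸ (Fin.succ_ne_zero k').symm),
      Finset.sum_eq_single k' (fun j _ hj => hother j.succ 2 lam (hk' ▸ by simpa using hj))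
        (by simp), ← hk', hself, hP]
    nlinarith

lemma ae_pi_nonneg {m : ℕ} (G : Fin (m + 1) → Measure ℝ)
    [∀ j, IsProbabilityMeasure (G j)]
    (hG_nonneg : ∀ j, G j (Set.Iio 0) = 0) :
    ∀ᵐ t ∂(Measure.pi G), ∀ i, 0 ≤ t i := by
  refine ae_all_iff.2 fun i => ?_
  have h : ∀ᵐ x ∂(G i), 0 ≤ x := by
    rw [ae_iff]
    simp only [not_le]
    exact hG_nonneg i
  exact Measure.tendsto_eval_ae_ae.eventually h

lemma integrable_pi_sum {m : ℕ} (G : Fin (m + 1) → Measure ℝ)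
    [∀ j, IsProbabilityMeasure (G j)]
    (hG_mean : ∀ j, Integrable id (G j)) :
    Integrable (fun t : Fin (m + 1) → ℝ => ∑ i, t i) (Measure.pi G) :=
  integrable_finsetSum _ fun i _ => integrable_comp_eval (f := id) (hG_mean i)

lemma lotteryRevenue_additive {m : ℕ} (G : Fin (m + 1) → Measure ℝ)
    {L : Set (Lottery m)} {s : (Fin m → ℝ) → Option (Lottery m)}
    (hs : IsSelection L s) :
    lotteryRevenue (Measure.map additiveVal (Measure.pi G)) s
      = ∫ t, selP (s (additiveVal t)) ∂(Measure.pi G) :=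
  integral_map measurable_additiveVal.aemeasurable hs.measP.aestronglyMeasurable

lemma IsSelection.integrable_price {m : ℕ} {G : Fin (m + 1) → Measure ℝ}
    [∀ j, IsProbabilityMeasure (G j)]
    (hG_nonneg : ∀ j, G j (Set.Iio 0) = 0) (hG_mean : ∀ j, Integrable id (G j))
    {L : Set (Lottery m)}
    {s : (Fin m → ℝ) → Option (Lottery m)} (hs : IsSelection L s) :
    Integrable (fun t => selP (s (additiveVal t))) (Measure.pi G) := by
  refine (integrable_pi_sum G hG_mean).mono'
    (hs.measP.comp measurable_additiveVal).aestronglyMeasurable ?_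
  filter_upwards [ae_pi_nonneg G hG_nonneg] with t ht
  rw [Real.norm_of_nonneg (selP_nonneg _)]
  exact hs.price_le_sum ht

lemma integral_price_le_optItemPricingRev {m : ℕ} {G : Fin (m + 1) → Measure ℝ}
    [∀ j, IsProbabilityMeasure (G j)]
    (hG_nonneg : ∀ j, G j (Set.Iio 0) = 0) (hG_mean : ∀ j, Integrable id (G j))
    {L : Set (Lottery m)}
    {s : (Fin m → ℝ) → Option (Lottery m)} (hL : L.Nonempty) (hI : IsItemPricing L)
    (hs : IsSelection L s) :
    ∫ t, selP (s (additiveVal t)) ∂(Measure.pi G)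
      ≤ optItemPricingRev (Measure.map additiveVal (Measure.pi G)) := by
  refine le_csSup ⟨∫ t, ∑ i, t i ∂(Measure.pi G), ?_⟩
    ⟨L, s, hL, hI, hs, (lotteryRevenue_additive G hs).symm⟩
  rintro _ ⟨L', s', -, -, hs', rfl⟩
  rw [lotteryRevenue_additive G hs']
  refine integral_mono_ae (hs'.integrable_price hG_nonneg hG_mean) (integrable_pi_sum G hG_mean) ?_
  filter_upwards [ae_pi_nonneg G hG_nonneg] with t ht
  exact hs'.price_le_sum ht

/-- Uniform item prices extract the posted-price revenue of the common component. -/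
lemma common_price_le_optItemPricingRev {m : ℕ} {G : Fin (m + 1) → Measure ℝ}
    [∀ j, IsProbabilityMeasure (G j)]
    (hG_nonneg : ∀ j, G j (Set.Iio 0) = 0) (hG_mean : ∀ j, Integrable id (G j))
    (hm : 0 < m) {p : ℝ} (hp : 0 ≤ p) :
    p * (G 0).real (Set.Ici p)
      ≤ optItemPricingRev (Measure.map additiveVal (Measure.pi G)) := by
  obtain ⟨L, s, J, hL, hI, hs, hJ, hsP⟩ :=
    exists_itemPricing_selection hm (fun _ => p) fun _ => hp
  refine le_trans ?_ (integral_price_le_optItemPricingRev hG_nonneg hG_mean hL hI hs)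
  have hmeas : MeasurableSet {t : Fin (m + 1) → ℝ | p ≤ t 0} :=
    measurableSet_le measurable_const (measurable_pi_apply 0)
  have hpr : (Measure.pi G).real {t : Fin (m + 1) → ℝ | p ≤ t 0} = (G 0).real (Set.Ici p) :=
    (measurePreserving_eval G 0).measureReal_preimage measurableSet_Ici.nullMeasurableSet
  calc p * (G 0).real (Set.Ici p)
      = ∫ t, {t : Fin (m + 1) → ℝ | p ≤ t 0}.indicator (fun _ => p) t ∂(Measure.pi G) := by
        rw [integral_indicator_const _ hmeas, hpr, smul_eq_mul, mul_comm]
    _ ≤ _ := by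
        refine integral_mono_ae ((integrable_const _).indicator hmeas)
          (hs.integrable_price hG_nonneg hG_mean) ?_
        filter_upwards [ae_pi_nonneg G hG_nonneg] with t ht
        by_cases h : p ≤ t 0
        · have := ht (J (additiveVal t)).succ
          rw [Set.indicator_of_mem (by exact h), hsP, if_pos]
          simp only [additiveVal]
          linarith
        · rw [Set.indicator_of_notMem (by exact h)]
          exact selP_nonneg _


/-- Item prices above a level `lam` that exceeds the optimal item-pricing revenue cannot collect
more than this revenue in excess of `lam` from separate buyers of the individual items. -/
lemma sum_excess_le_optItemPricingRev {m : ℕ} {G : Fin (m + 1) → Measure ℝ}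
    [∀ j, IsProbabilityMeasure (G j)]
    (hG_nonneg : ∀ j, G j (Set.Iio 0) = 0) (hG_mean : ∀ j, Integrable id (G j))
    (hm : 0 < m) {lam : ℝ} (hlam0 : 0 ≤ lam)
    (hlam : optItemPricingRev (Measure.map additiveVal (Measure.pi G)) < lam)
    {p : Fin m → ℝ} (hp : ∀ j, lam ≤ p j) :
    ∑ j : Fin m, (p j - lam) * (G j.succ).real (Set.Ici (p j))
      ≤ optItemPricingRev (Measure.map additiveVal (Measure.pi G)) := by
  classical
  set R := optItemPricingRev (Measure.map additiveVal (Measure.pi G)) with hR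
  obtain ⟨L, s, J, hL, hI, hs, hJ, hsP⟩ :=
    exists_itemPricing_selection hm p fun j => hlam0.trans (hp j)
  have hrev := integral_price_le_optItemPricingRev hG_nonneg hG_mean hL hI hs
  rw [← hR] at hrev
  let F : Fin m → ℝ := fun j => (G j.succ).real (Set.Ici (p j))
  have hF0 : ∀ j, 0 ≤ F j := fun j => measureReal_nonneg
  have hF1 : ∀ j, F j ≤ 1 := fun j => measureReal_le_one
  have hFc : ∀ j, (G j.succ).real (Set.Iio (p j)) = 1 - F j := fun j => by
    rw [← Set.compl_Ici, measureReal_compl measurableSet_Ici, probReal_univ]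
  let box : (Fin m → Set ℝ) → Set (Fin (m + 1) → ℝ) := fun B =>
    Set.univ.pi (Fin.cons Set.univ B : Fin (m + 1) → Set ℝ)
  have hbox : ∀ B t, t ∈ box B ↔ ∀ j : Fin m, t j.succ ∈ B j := fun B t => by
    simp [box, Fin.forall_fin_succ]
  have hboxm : ∀ B : Fin m → Set ℝ, (∀ j, MeasurableSet (B j)) → MeasurableSet (box B) := by
    intro B hB
    refine MeasurableSet.univ_pi fun i => ?_
    cases i using Fin.cases with
    | zero => exact MeasurableSet.univ
    | succ j => exact hB j
  have hboxP : ∀ B : Fin m → Set ℝ,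
      (Measure.pi G).real (box B) = ∏ j, (G j.succ).real (B j) := by
    intro B
    simp [box, Measure.real, Measure.pi_pi, Fin.prod_univ_succ, ENNReal.toReal_prod]
  let Nb : Fin m → Set ℝ := fun j => Set.Iio (p j)
  let Xb : Fin m → Fin m → Set ℝ := fun j => Function.update Nb j (Set.Ici (p j))
  have hNm : MeasurableSet (box Nb) := hboxm _ fun j => measurableSet_Iio
  have hXm : ∀ j, MeasurableSet (box (Xb j)) := fun j => hboxm _ fun i => by
    by_cases h : i = j
    · subst h; simp [Xb]
    · simp [Xb, h, Nb]
  set Pr : ℝ := ∏ j, (1 - F j) with hPr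
  have hPr0 : 0 ≤ Pr := Finset.prod_nonneg fun j _ => by linarith [hF1 j]
  have hPr1 : Pr ≤ 1 := Finset.prod_le_one (fun j _ => by linarith [hF1 j])
    fun j _ => by linarith [hF0 j]
  have hNP : (Measure.pi G).real (box Nb) = Pr := by
    rw [hboxP]; simp only [Nb, hFc, hPr]
  have hXP : ∀ j, F j * Pr ≤ (Measure.pi G).real (box (Xb j)) := by
    intro j
    rw [hboxP, ← Finset.mul_prod_erase _ _ (Finset.mem_univ j), hPr,
      ← Finset.mul_prod_erase _ _ (Finset.mem_univ j)]
    have h1 : ∏ i ∈ Finset.univ.erase j, (G i.succ).real (Xb j i)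
        = ∏ i ∈ Finset.univ.erase j, (1 - F i) := by
      refine Finset.prod_congr rfl fun i hi => ?_
      simp only [Xb, Function.update_of_ne (Finset.ne_of_mem_erase hi), Nb, hFc]
    have h2 : (G j.succ).real (Xb j j) = F j := by simp [Xb, F]
    rw [h1, h2]
    have h3 : 0 ≤ ∏ i ∈ Finset.univ.erase j, (1 - F i) :=
      Finset.prod_nonneg fun i _ => by linarith [hF1 i]
    have h4 : (1 - F j) * ∏ i ∈ Finset.univ.erase j, (1 - F i)
        ≤ ∏ i ∈ Finset.univ.erase j, (1 - F i) :=
      mul_le_of_le_one_left h3 (by linarith [hF0 j])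
    exact mul_le_mul_of_nonneg_left h4 (hF0 j)
  have hlow : ∀ t : Fin (m + 1) → ℝ, (∀ i, 0 ≤ t i) →
      (box Nb)ᶜ.indicator (fun _ => lam) t
        + ∑ j, (box (Xb j)).indicator (fun _ => p j - lam) t ≤ selP (s (additiveVal t)) := by
    intro t ht
    set k := J (additiveVal t) with hk
    have hkmax : ∀ i, t i.succ - p i ≤ t k.succ - p k := fun i => by
      have := hJ (additiveVal t) i
      simp only [additiveVal] at this
      linarith
    by_cases hN : t ∈ box Nb
    · have hX : ∀ j, (box (Xb j)).indicator (fun _ => p j - lam) t = 0 := by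
        intro j
        refine Set.indicator_of_notMem (fun hX => ?_) _
        have h1 := (hbox _ _).1 hX j
        have h2 := (hbox _ _).1 hN j
        simp only [Xb, Nb, Function.update_self, Set.mem_Ici, Set.mem_Iio] at h1 h2
        linarith
      rw [Set.indicator_of_notMem (by simpa using hN), Finset.sum_eq_zero fun j _ => hX j]
      simpa using selP_nonneg _
    · have hpk : p k ≤ t k.succ := by
        by_contra hlt
        refine hN ((hbox _ _).2 fun i => ?_)
        have := hkmax i
        simp only [Nb, Set.mem_Iio]
        linarith
      have hX : ∀ j, j ≠ k → (box (Xb j)).indicator (fun _ => p j - lam) t = 0 := by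
        intro j hj
        refine Set.indicator_of_notMem (fun hX => ?_) _
        have h1 := (hbox _ _).1 hX k
        simp only [Xb, Nb, Function.update_of_ne hj.symm, Set.mem_Iio] at h1
        linarith
      rw [Set.indicator_of_mem (by simpa using hN), hsP, ← hk, if_pos (by
        simp only [additiveVal]; linarith [ht 0]),
        Finset.sum_eq_single k (fun j _ hj => hX j hj) (by simp)]
      have := Set.indicator_le_self' (s := box (Xb k)) (f := fun _ => p k - lam)
        (fun _ _ => by linarith [hp k]) t
      linarith
  have hint1 : Integrable ((box Nb)ᶜ.indicator fun _ => lam) (Measure.pi G) :=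
    (integrable_const _).indicator hNm.compl
  have hint2 : ∀ j, Integrable ((box (Xb j)).indicator fun _ => p j - lam) (Measure.pi G) :=
    fun j => (integrable_const _).indicator (hXm j)
  have hmain : lam * (1 - Pr) + Pr * ∑ j, (p j - lam) * F j ≤ R := by
    refine le_trans ?_ hrev
    calc lam * (1 - Pr) + Pr * ∑ j, (p j - lam) * F j
        ≤ lam * (1 - Pr) + ∑ j, (p j - lam) * (Measure.pi G).real (box (Xb j)) := by
          rw [Finset.mul_sum]
          refine add_le_add le_rfl (Finset.sum_le_sum fun j _ => ?_)
          have := mul_le_mul_of_nonneg_left (hXP j) (sub_nonneg.2 (hp j))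
          linarith
      _ = ∫ t, ((box Nb)ᶜ.indicator (fun _ => lam) t
          + ∑ j, (box (Xb j)).indicator (fun _ => p j - lam) t) ∂(Measure.pi G) := by
          rw [integral_add hint1 (integrable_finsetSum _ fun j _ => hint2 j),
            integral_finsetSum _ fun j _ => hint2 j, integral_indicator_const _ hNm.compl,
            measureReal_compl hNm, hNP, probReal_univ, smul_eq_mul, mul_comm]
          congr 1
          refine Finset.sum_congr rfl fun j _ => ?_
          rw [integral_indicator_const _ (hXm j), smul_eq_mul, mul_comm]
      _ ≤ _ := by
          refine integral_mono_ae (hint1.add (integrable_finsetSum _ fun j _ => hint2 j))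
            (hs.integrable_price hG_nonneg hG_mean) ?_
          filter_upwards [ae_pi_nonneg G hG_nonneg] with t ht
          exact hlow t ht
  by_contra! hcon
  change R < ∑ j, (p j - lam) * F j at hcon
  rcases hPr0.eq_or_lt with h0 | h0
  · rw [← h0] at hmain
    linarith
  · nlinarith [mul_nonneg (sub_nonneg.2 hlam.le) (sub_nonneg.2 hPr1),
      mul_pos h0 (sub_pos.2 hcon)]

lemma favouriteExcess_integrable {m : ℕ} {G : Fin (m + 1) → Measure ℝ}
    [∀ j, IsProbabilityMeasure (G j)]
    (hG_mean : ∀ j, Integrable id (G j))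
    {L : Set (Lottery m)}
    {s : (Fin m → ℝ) → Option (Lottery m)} (hs : IsSelection L s)
    {J : (Fin (m + 1) → ℝ) → Fin (m + 1)} (hJ : Measurable J) (hm : 0 < m) (j : Fin (m + 1))
    {c lam : ℝ} (hc : 0 ≤ c) (hlam : 0 ≤ lam) :
    Integrable (favouriteExcess s J j c lam) (Measure.pi G) := by
  have : Nonempty (Fin m) := ⟨⟨0, hm⟩⟩
  have hset : MeasurableSet {t : Fin (m + 1) → ℝ | J t = j ∧ ∀ i, 0 ≤ t i} :=
    (hJ (measurableSet_singleton j)).inter measurableSet_forall_nonneg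
  have hmeas : Measurable (favouriteExcess s J j c lam) := by
    refine Measurable.indicator ?_ hset
    have hM : Measurable fun t : Fin (m + 1) → ℝ => ⨆ i, t (j.succAbove i) :=
      Measurable.iSup (f := fun (i : Fin m) (t : Fin (m + 1) → ℝ) => t (j.succAbove i))
        fun i => measurable_pi_apply _
    have hQ := hs.measurable_typeAlloc j
    have hU := hs.measurable_typeUtil
    have hj : Measurable fun t : Fin (m + 1) → ℝ => t j := measurable_pi_apply j
    exact ((hQ.add_const c).mul (hj.sub_const lam)).sub (hU.add ((hj.sub hM).const_mul c))
  refine (((integrable_pi_sum G hG_mean).abs.const_mul (2 + 2 * c)).add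
    (integrable_const ((1 + c) * lam))).mono' hmeas.aestronglyMeasurable (.of_forall fun t => ?_)
  have hS := le_abs_self (∑ i, t i)
  have hS0 := abs_nonneg (∑ i, t i)
  simp only [Pi.add_apply]
  by_cases ht : J t = j ∧ ∀ i, 0 ≤ t i
  · rw [favouriteExcess, Set.indicator_of_mem (by exact ht), Real.norm_eq_abs]
    have ht0 := ht.2
    have hle : ∀ i, t i ≤ ∑ i, t i := fun i =>
      Finset.single_le_sum (fun i _ => ht0 i) (Finset.mem_univ i)
    set M := ⨆ i, t (j.succAbove i)
    have hM : M ≤ ∑ i, t i := ciSup_le fun i => hle _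
    have hM0 : 0 ≤ M := Real.iSup_nonneg fun i => ht0 _
    have hq0 := typeAlloc_nonneg (s (additiveVal t)) j
    have hq1 := typeAlloc_le_one (s (additiveVal t)) j
    have hU0 := hs.typeUtil_nonneg ht0
    have hU := typeUtil_le s ht0
    set S := ∑ i, t i
    set q := typeAlloc (s (additiveVal t)) j
    have e : (q + c) * (t j - lam) - (typeUtil s t + c * (t j - M))
        = q * t j + c * M - typeUtil s t - (q + c) * lam := by ring
    rw [e]
    have h1 : 0 ≤ q * t j := mul_nonneg hq0 (ht0 j)
    have h2 : q * t j ≤ S := (mul_le_of_le_one_left (ht0 j) hq1).trans (hle j)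
    have h3 : 0 ≤ c * M := mul_nonneg hc hM0
    have h4 : c * M ≤ c * S := mul_le_mul_of_nonneg_left hM hc
    have h5 : 0 ≤ (q + c) * lam := mul_nonneg (add_nonneg hq0 hc) hlam
    have h6 : (q + c) * lam ≤ (1 + c) * lam := by gcongr
    have h7 : c * S ≤ c * |S| := mul_le_mul_of_nonneg_left hS hc
    rw [abs_le]
    constructor <;> nlinarith
  · rw [favouriteExcess, Set.indicator_of_notMem (by exact ht), norm_zero]
    positivity

lemma integral_favouriteExcess_le {m : ℕ} {G : Fin (m + 1) → Measure ℝ}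
    [∀ j, IsProbabilityMeasure (G j)]
    (hG_mean : ∀ j, Integrable id (G j))
    {L : Set (Lottery m)}
    {s : (Fin m → ℝ) → Option (Lottery m)} (hs : IsSelection L s)
    {J : (Fin (m + 1) → ℝ) → Fin (m + 1)} (hJ : Measurable J)
    (hJmax : ∀ (t : Fin (m + 1) → ℝ) i, t i ≤ t (J t))
    (hm : 0 < m) (j : Fin (m + 1)) {c lam h : ℝ} (hc : 0 ≤ c) (hlam : 0 ≤ lam)
    (hprice : ∀ p, lam ≤ p → (p - lam) * (G j).real (Set.Ici p) ≤ h) :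
    ∫ t, favouriteExcess s J j c lam t ∂(Measure.pi G) ≤ (1 + c) * h := by
  have : Nonempty (Fin m) := ⟨⟨0, hm⟩⟩
  have hh : 0 ≤ h := by simpa using hprice lam le_rfl
  refine integral_pi_le_of_insertNth G
    (favouriteExcess_integrable hG_mean hs hJ hm j hc hlam) j fun r => ?_
  let ins : ℝ → Fin (m + 1) → ℝ := fun x => j.insertNth x r
  have hins : Measurable ins := by
    refine measurable_pi_iff.2 (j.forall_iff_succAbove.2 ⟨?_, fun i => ?_⟩)
    · simpa [ins] using measurable_id'
    · simp [ins]
  let S : Set ℝ := {x | J (ins x) = j ∧ ∀ i, 0 ≤ ins x i}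
  have hS : MeasurableSet S :=
    ((hJ.comp hins) (measurableSet_singleton j)).inter (hins measurableSet_forall_nonneg)
  have hrM : ∀ x ∈ S, ⨆ i, r i ≤ x := fun x hx => ciSup_le fun i => by
    have := hJmax (ins x) (j.succAbove i)
    rw [hx.1] at this
    simpa [ins] using this
  have heq : ∀ x, favouriteExcess s J j c lam (j.insertNth x r)
      = S.indicator (fun x => (typeAlloc (s (additiveVal (ins x))) j + c) * (x - lam)
          - (typeUtil s (ins x) + c * (x - ⨆ i, r i))) x := by
    intro x
    by_cases hx : x ∈ S
    · rw [Set.indicator_of_mem hx, favouriteExcess, Set.indicator_of_mem (by exact hx)]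
      simp [ins]
    · rw [Set.indicator_of_notMem hx, favouriteExcess, Set.indicator_of_notMem (by exact hx)]
  simp_rw [heq]
  rw [integral_indicator hS]
  refine setIntegral_allocation_sub_utility_le (G j) (hG_mean j) hS
    (x := fun x => typeAlloc (s (additiveVal (ins x))) j + c)
    (u := fun x => typeUtil s (ins x) + c * (x - ⨆ i, r i))
    (fun x hx => by simpa [ins] using hx.2 j)
    (((hs.measurable_typeAlloc j).comp hins).add_const c) (by positivity) hh hprice ?_ ?_ ?_ ?_
  · exact fun x _ => add_nonneg (typeAlloc_nonneg _ _) hc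
  · exact fun x _ => by linarith [typeAlloc_le_one (s (additiveVal (ins x))) j]
  · exact fun x hx => add_nonneg (hs.typeUtil_nonneg hx.2)
      (mul_nonneg hc (sub_nonneg.2 (hrM x hx)))
  · intro x hx y hy
    have h1 := hs.typeUtil_ge hx.2 hy.2
    have h2 : ∑ i, typeAlloc (s (additiveVal (ins x))) i * (ins y i - ins x i)
        = typeAlloc (s (additiveVal (ins x))) j * (y - x) := by
      rw [Fin.sum_univ_succAbove _ j]
      simp [ins]
    rw [h2] at h1
    linarith

lemma integral_price_le_of_lt {m : ℕ} {G : Fin (m + 1) → Measure ℝ}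
    [∀ j, IsProbabilityMeasure (G j)]
    (hG_nonneg : ∀ j, G j (Set.Iio 0) = 0) (hG_mean : ∀ j, Integrable id (G j))
    {L : Set (Lottery m)}
    {s : (Fin m → ℝ) → Option (Lottery m)} (hs : IsSelection L s) (hm : 0 < m) {lam : ℝ}
    (hlam0 : 0 ≤ lam)
    (hlam : optItemPricingRev (Measure.map additiveVal (Measure.pi G)) < lam) :
    ∫ t, selP (s (additiveVal t)) ∂(Measure.pi G)
      ≤ 5 * optItemPricingRev (Measure.map additiveVal (Measure.pi G)) + 3 * lam := by
  set R := optItemPricingRev (Measure.map additiveVal (Measure.pi G)) with hR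
  obtain ⟨J, hJ, hJmax⟩ := exists_measurable_argmax (m + 1) (Nat.succ_pos m)
  let f : Fin m → Set.Ici lam → ℝ := fun j p => (p - lam) * (G j.succ).real (Set.Ici (p : ℝ))
  have hsum : ∀ p : Fin m → Set.Ici lam, ∑ j, f j (p j) ≤ R := fun p =>
    sum_excess_le_optItemPricingRev hG_nonneg hG_mean hm hlam0 hlam fun j => (p j).2
  have hf0 : ∀ j p, 0 ≤ f j p := fun j p => mul_nonneg (sub_nonneg.2 p.2) measureReal_nonneg
  have hbdd : ∀ j, BddAbove (Set.range (f j)) := by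
    refine fun j => ⟨R, ?_⟩
    rintro _ ⟨p, rfl⟩
    exact (Finset.single_le_sum (f := fun j => f j p) (fun i _ => hf0 i p)
      (Finset.mem_univ j)).trans (hsum fun _ => p)
  have hsup : ∑ j, ⨆ p, f j p ≤ R := by
    refine le_of_forall_pos_le_add fun ε hε => ?_
    have hm' : (0 : ℝ) < m := by exact_mod_cast hm
    choose p hp using fun j => exists_lt_of_lt_ciSup
      (show (⨆ p, f j p) - ε / m < ⨆ p, f j p by
        have : 0 < ε / m := by positivity
        linarith)
    calc ∑ j, ⨆ p, f j p ≤ ∑ j, (f j (p j) + ε / m) :=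
          Finset.sum_le_sum fun j _ => by linarith [hp j]
      _ = ∑ j, f j (p j) + ε := by
          rw [Finset.sum_add_distrib, Finset.sum_const, Finset.card_univ, Fintype.card_fin,
            nsmul_eq_mul, mul_div_cancel₀ _ hm'.ne']
      _ ≤ R + ε := by linarith [hsum p]
  have hi0 := favouriteExcess_integrable hG_mean hs hJ hm 0 zero_le_one le_rfl
  have hi : ∀ j : Fin m, Integrable (favouriteExcess s J j.succ 2 lam) (Measure.pi G) := fun j =>
    favouriteExcess_integrable hG_mean hs hJ hm j.succ zero_le_two hlam0
  have hE0 : ∫ t, favouriteExcess s J 0 1 0 t ∂(Measure.pi G) ≤ 2 * R := by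
    have := integral_favouriteExcess_le hG_mean hs hJ hJmax hm 0 zero_le_one le_rfl
      (h := R) fun p hp => by
        simpa using common_price_le_optItemPricingRev hG_nonneg hG_mean hm hp
    linarith
  have hE : ∀ j : Fin m,
      ∫ t, favouriteExcess s J j.succ 2 lam t ∂(Measure.pi G) ≤ 3 * ⨆ p, f j p := by
    intro j
    have := integral_favouriteExcess_le hG_mean hs hJ hJmax hm j.succ zero_le_two hlam0
      (h := ⨆ p, f j p) fun p hp => le_ciSup (hbdd j) ⟨p, hp⟩
    linarith
  calc ∫ t, selP (s (additiveVal t)) ∂(Measure.pi G)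
      ≤ ∫ t, (favouriteExcess s J 0 1 0 t
          + ∑ j : Fin m, favouriteExcess s J j.succ 2 lam t + 3 * lam) ∂(Measure.pi G) := by
        refine integral_mono_ae (hs.integrable_price hG_nonneg hG_mean)
          ((hi0.add (integrable_finsetSum _ fun j _ => hi j)).add (integrable_const _)) ?_
        filter_upwards [ae_pi_nonneg G hG_nonneg] with t ht
        exact price_le_sum_favouriteExcess hm hlam0 ht
    _ = ∫ t, favouriteExcess s J 0 1 0 t ∂(Measure.pi G)
          + ∑ j : Fin m, ∫ t, favouriteExcess s J j.succ 2 lam t ∂(Measure.pi G) + 3 * lam := by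
        have hi' := hi0.add (integrable_finsetSum Finset.univ fun j _ => hi j)
        simp only [Pi.add_def] at hi'
        rw [integral_add hi' (integrable_const _),
          integral_add hi0 (integrable_finsetSum _ fun j _ => hi j),
          integral_finsetSum _ fun j _ => hi j]
        simp
    _ ≤ 2 * R + ∑ j, (3 * ⨆ p, f j p) + 3 * lam := by
        gcongr with j
        exact hE j
    _ ≤ 5 * R + 3 * lam := by
        rw [← Finset.mul_sum]
        linarith

lemma eighth_optLotteryRev_le {m : ℕ} {G : Fin (m + 1) → Measure ℝ}
    [∀ j, IsProbabilityMeasure (G j)]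
    (hG_nonneg : ∀ j, G j (Set.Iio 0) = 0) (hG_mean : ∀ j, Integrable id (G j)) :
    (1 / 8) * optLotteryRev (Measure.map additiveVal (Measure.pi G))
      ≤ optItemPricingRev (Measure.map additiveVal (Measure.pi G)) := by
  have hR0 : 0 ≤ optItemPricingRev (Measure.map additiveVal (Measure.pi G)) := by
    refine Real.sSup_nonneg ?_
    rintro _ ⟨L, s, -, -, hs, rfl⟩
    exact integral_nonneg fun v => selP_nonneg _
  suffices h : optLotteryRev (Measure.map additiveVal (Measure.pi G))
      ≤ 8 * optItemPricingRev (Measure.map additiveVal (Measure.pi G)) by linarith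
  refine Real.sSup_le ?_ (by linarith)
  rintro _ ⟨L, s, -, hs, rfl⟩
  rw [lotteryRevenue_additive G hs]
  rcases Nat.eq_zero_or_pos m with rfl | hm
  · have : ∀ t : Fin 1 → ℝ, selP (s (additiveVal t)) = 0 := fun t =>
      le_antisymm (by simpa using hs.price_le (v := additiveVal t) fun j => j.elim0)
        (selP_nonneg _)
    simp only [this, integral_zero]
    linarith
  · refine le_of_forall_pos_le_add fun ε hε => ?_
    have := integral_price_le_of_lt hG_nonneg hG_mean hs hm
      (lam := optItemPricingRev (Measure.map additiveVal (Measure.pi G)) + ε / 3)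
      (by positivity) (by linarith)
    linarith

/-- A single unit-demand buyer with additive values: the type
`(t 0, t 1, …, t m)` is drawn from the product of `G 0, …, G m` (Borel
distributions on `ℝ≥0` with finite mean) and the value for item `j` is
`v j = t 0 + t j`. Under the induced valuation distribution `μ`, the optimal
item-pricing revenue is at least one eighth of the optimal lottery revenue. -/
theorem optItemPricing_ge_eighth_optLottery_additive
    {m : ℕ} (G : Fin (m + 1) → Measure ℝ) [∀ j, IsProbabilityMeasure (G j)]
    (hG_nonneg : ∀ j, G j (Set.Iio 0) = 0)
    (hG_mean : ∀ j, Integrable id (G j)) :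
    (1 / 8) * optLotteryRev
        (Measure.map (fun (t : Fin (m + 1) → ℝ) (j : Fin m) => t 0 + t j.succ)
          (Measure.pi G)) ≤
      optItemPricingRev
        (Measure.map (fun (t : Fin (m + 1) → ℝ) (j : Fin m) => t 0 + t j.succ)
          (Measure.pi G)) := by
  exact eighth_optLotteryRev_le hG_nonneg hG_mean
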